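/- Let U be a numeration system satisfying (H1), (H2) and (H3) that is linear with coefficients a_0,…,a_{k−1}. Let Z be an integer such that for every greedy U-representation w and every z ≥ Z, the word 10^z w is again a greedy U-representation. Let X ⊆ ℕ be an ultimately periodic set whose period factors as π_X = Q·p_1^{μ_1}⋯p_t^{μ_t} with t ≥ 1, where p_1,…,p_t are distinct primes each dividing every coefficient a_0,…,a_{k−1}, each μ_j ≥ 1, and no prime factor of Q divides all of a_0,…,a_{k−1}. Let r ∈ {0,…,Q−1} and ν_1,…,ν_t ≥ 0 be such that X ∩ (Qℕ + r) is ultimately periodic with minimal period ρ = Q·p_1^{ν_1}⋯p_t^{ν_t}. For each j, let f_{p_j}(ν_j) be the least index F such that p_j^{ν_j} divides U_i for all i ≥ F (such F exists since p_j divides all the coefficients), and set M = max_{1≤j≤t} f_{p_j}(ν_j). Assume M − 1 − |rep_U(ρ−1)| ≥ Z and that M is greater than the preperiod of the eventually periodic sequence (U_i mod Q)_{i≥0}. Let γ ≥ 1 be such that for each r' ∈ {0,…,Q−1} there is a deterministic finite automaton with at most γ states accepting 0*rep_U(Qℕ + r'). Then every deterministic finite automaton accepting 0*rep_U(X) has at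 least (|rep_U(ρ−1)| + 1)/γ states. -/

import Mathlib

/-- The `U`-numerical value of a word over `ℕ`, most significant digit first. -/
def valU (U : ℕ → ℕ) (w : List ℕ) : ℕ :=
  ∑ i ∈ Finset.range w.length, w.reverse.getD i 0 * U i

/-- `w` is a greedy `U`-representation. -/
def IsGreedyRep (U : ℕ → ℕ) (w : List ℕ) : Prop :=
  w.head? ≠ some 0 ∧
    ∀ t < w.length, ∑ i ∈ Finset.range (t + 1), w.reverse.getD i 0 * U i < U (t + 1)

/-- `U` is a numeration system. -/
structure IsNumSys (U : ℕ → ℕ) : Prop where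
  mono : StrictMono U
  base : U 0 = 1
  ratio : ∃ C : ℕ, ∀ i, U (i + 1) ≤ C * U i

/-- The language `0* rep_U(X)` of greedy `U`-representations of elements of `X`, possibly
preceded by leading zeroes. -/
def zeroStarRepLang (U : ℕ → ℕ) (X : Set ℕ) : Language ℕ :=
  {w | ∃ (z : ℕ) (w' : List ℕ),
    w = List.replicate z 0 ++ w' ∧ IsGreedyRep U w' ∧ valU U w' ∈ X}

/-- A language is regular if it is accepted by a DFA with finitely many states. -/
def IsRegularLang {α : Type} (L : Language α) : Prop :=
  ∃ (σ : Type) (_ : Fintype σ) (M : DFA α σ), M.accepts = L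

/-- (H2): `limsup (U (i+1) - U i) = +∞`. -/
def GapsUnbounded (U : ℕ → ℕ) : Prop :=
  ∀ B : ℕ, ∃ᶠ i in Filter.atTop, B ≤ U (i + 1) - U i

/-- (H3): the gap sequence is ultimately non-decreasing. -/
def GapsUltNondecreasing (U : ℕ → ℕ) : Prop :=
  ∃ G : ℕ, ∀ i ≥ G, U (i + 1) - U i ≤ U (i + 2) - U (i + 1)

/-- `p` is a period of `X` from index `a` on. -/
def PeriodFrom (X : Set ℕ) (a p : ℕ) : Prop := ∀ n, a ≤ n → (n ∈ X ↔ n + p ∈ X)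

/-- `X` is ultimately periodic with (minimal) period `p`. -/
def HasMinPeriod (X : Set ℕ) (p : ℕ) : Prop :=
  1 ≤ p ∧ (∃ a, PeriodFrom X a p) ∧ ∀ q, 1 ≤ q → (∃ a, PeriodFrom X a q) → p ≤ q

/-- The length of the greedy `U`-representation of `n`: for `n ≥ 1` it is the least `ℓ`
with `n < U ℓ`. -/
noncomputable def repLen (U : ℕ → ℕ) (n : ℕ) : ℕ := sInf {ℓ : ℕ | n < U ℓ}

/-- Every suffix of `w`, read as a digit string, has value below the next term of `U`: the
greedy condition without the restriction on the leading digit. -/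
def IsGreedyPadded (U : ℕ → ℕ) (w : List ℕ) : Prop :=
  ∀ t < w.length, ∑ i ∈ Finset.range (t + 1), w.reverse.getD i 0 * U i < U (t + 1)

theorem sum_getD_reverse_cons (U : ℕ → ℕ) (d : ℕ) (w : List ℕ) {n : ℕ} (hn : n ≤ w.length) :
    ∑ i ∈ Finset.range n, (d :: w).reverse.getD i 0 * U i =
      ∑ i ∈ Finset.range n, w.reverse.getD i 0 * U i := by
  refine Finset.sum_congr rfl fun i hi => ?_
  have hi' : i < w.reverse.length := by
    have := Finset.mem_range.1 hi
    rw [List.length_reverse]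
    omega
  rw [List.reverse_cons, List.getD_append _ _ _ _ hi']

theorem valU_cons (U : ℕ → ℕ) (d : ℕ) (w : List ℕ) :
    valU U (d :: w) = d * U w.length + valU U w := by
  rw [valU, List.length_cons, Finset.sum_range_succ, sum_getD_reverse_cons U d w le_rfl, valU,
    add_comm]
  simp

theorem valU_replicate_zero_append (U : ℕ → ℕ) (z : ℕ) (w : List ℕ) :
    valU U (List.replicate z 0 ++ w) = valU U w := by
  induction z with
  | zero => simp
  | succ z ih => rw [List.replicate_succ, List.cons_append, valU_cons, ih, zero_mul, zero_add]

theorem valU_one_cons_replicate_zero_append (U : ℕ → ℕ) (z : ℕ) (w : List ℕ) :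
    valU U (1 :: (List.replicate z 0 ++ w)) = U (z + w.length) + valU U w := by
  rw [valU_cons, valU_replicate_zero_append, one_mul, List.length_append, List.length_replicate]

theorem isGreedyPadded_nil (U : ℕ → ℕ) : IsGreedyPadded U [] := by
  intro t ht
  simp at ht

theorem isGreedyPadded_cons (U : ℕ → ℕ) (d : ℕ) (w : List ℕ) :
    IsGreedyPadded U (d :: w) ↔
      IsGreedyPadded U w ∧ valU U (d :: w) < U (w.length + 1) := by
  constructor
  · intro h
    refine ⟨fun t ht => ?_, h w.length (by simp)⟩
    rw [← sum_getD_reverse_cons U d w (by omega)]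
    exact h t (by rw [List.length_cons]; omega)
  · rintro ⟨h, h'⟩ t ht
    rw [List.length_cons] at ht
    rcases Nat.lt_succ_iff_lt_or_eq.1 ht with ht | rfl
    · rw [sum_getD_reverse_cons U d w (by omega)]
      exact h t ht
    · exact h'

theorem IsGreedyPadded.of_append {U : ℕ → ℕ} {u w : List ℕ} (h : IsGreedyPadded U (u ++ w)) :
    IsGreedyPadded U w := by
  induction u with
  | nil => exact h
  | cons d u ih => exact ih ((isGreedyPadded_cons U d (u ++ w)).1 h).1

theorem IsGreedyPadded.valU_lt {U : ℕ → ℕ} (hU : IsNumSys U) {w : List ℕ}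
    (h : IsGreedyPadded U w) : valU U w < U w.length := by
  cases w with
  | nil => simp [valU, hU.base]
  | cons d w => exact ((isGreedyPadded_cons U d w).1 h).2

theorem IsGreedyPadded.replicate_zero_append {U : ℕ → ℕ} (hU : IsNumSys U) {w : List ℕ}
    (h : IsGreedyPadded U w) (z : ℕ) : IsGreedyPadded U (List.replicate z 0 ++ w) := by
  induction z with
  | zero => simpa using h
  | succ z ih =>
    rw [List.replicate_succ, List.cons_append, isGreedyPadded_cons, valU_cons, zero_mul, zero_add]
    exact ⟨ih, (ih.valU_lt hU).trans (hU.mono (Nat.lt_succ_self _))⟩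

theorem exists_eq_replicate_zero_append (w : List ℕ) :
    ∃ (z : ℕ) (w' : List ℕ), w = List.replicate z 0 ++ w' ∧ w'.head? ≠ some 0 := by
  induction w with
  | nil => exact ⟨0, [], by simp⟩
  | cons d w ih =>
    obtain ⟨z, w', hw, hh⟩ := ih
    by_cases hd : d = 0
    · exact ⟨z + 1, w', by rw [hd, hw, List.replicate_succ, List.cons_append], hh⟩
    · exact ⟨0, d :: w, by simp, by simpa using hd⟩

theorem mem_zeroStarRepLang_iff {U : ℕ → ℕ} (hU : IsNumSys U) (X : Set ℕ) (w : List ℕ) :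
    w ∈ zeroStarRepLang U X ↔ IsGreedyPadded U w ∧ valU U w ∈ X := by
  constructor
  · rintro ⟨z, w', rfl, hw', hX⟩
    rw [valU_replicate_zero_append]
    exact ⟨IsGreedyPadded.replicate_zero_append hU hw'.2 z, hX⟩
  · rintro ⟨hw, hX⟩
    obtain ⟨z, w', rfl, hh⟩ := exists_eq_replicate_zero_append w
    rw [valU_replicate_zero_append] at hX
    exact ⟨z, w', rfl, ⟨hh, hw.of_append⟩, hX⟩

theorem exists_isGreedyPadded_valU_eq {U : ℕ → ℕ} (hU : IsNumSys U) (l n : ℕ) (hn : n < U l) :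
    ∃ w : List ℕ, w.length = l ∧ IsGreedyPadded U w ∧ valU U w = n := by
  induction l generalizing n with
  | zero =>
    rw [hU.base] at hn
    exact ⟨[], rfl, isGreedyPadded_nil U, by simp [valU]; omega⟩
  | succ l ih =>
    have hpos : 0 < U l := (by rw [hU.base]; exact one_pos : 0 < U 0).trans_le
      (hU.mono.monotone (Nat.zero_le l))
    obtain ⟨w, hl, hw, hv⟩ := ih (n % U l) (Nat.mod_lt _ hpos)
    have hval : valU U (n / U l :: w) = n := by
      rw [valU_cons, hl, hv, Nat.div_add_mod']
    exact ⟨n / U l :: w, by rw [List.length_cons, hl],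
      (isGreedyPadded_cons U _ w).2 ⟨hw, by rwa [hval, hl]⟩, hval⟩

theorem IsGreedyPadded.one_cons_replicate_zero_append {U : ℕ → ℕ} {Z : ℕ}
    (hZ : ∀ w : List ℕ, IsGreedyRep U w →
      ∀ z ≥ Z, IsGreedyRep U (1 :: (List.replicate z 0 ++ w)))
    {w : List ℕ} (hw : IsGreedyPadded U w) {z : ℕ} (hz : Z ≤ z) :
    IsGreedyPadded U (1 :: (List.replicate z 0 ++ w)) := by
  obtain ⟨y, w', rfl, hh⟩ := exists_eq_replicate_zero_append w
  have h := (hZ w' ⟨hh, hw.of_append⟩ (z + y) (hz.trans (Nat.le_add_right z y))).2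
  rwa [List.replicate_add, List.append_assoc] at h

/-- If two states are separated by a word of length `l` but by no longer word, then the
automaton has more than `l` states. -/
theorem DFA.length_succ_le_card {α σ : Type*} [Fintype σ] (D : DFA α σ) (q q' : σ) (w : List α)
    (hw : ¬ (D.evalFrom q w ∈ D.accept ↔ D.evalFrom q' w ∈ D.accept))
    (hlong : ∀ x : List α, w.length < x.length →
      (D.evalFrom q x ∈ D.accept ↔ D.evalFrom q' x ∈ D.accept)) :
    w.length + 1 ≤ Fintype.card σ := by
  classical
  let A : Matrix (Fin (w.length + 1)) σ ℚ := fun i s =>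
    (if s = D.evalFrom q (w.take i) then 1 else 0) -
      (if s = D.evalFrom q' (w.take i) then 1 else 0)
  let B : Matrix σ (Fin (w.length + 1)) ℚ := fun s j =>
    if D.evalFrom s (w.drop j) ∈ D.accept then 1 else 0
  have hAB : ∀ i j, (A * B) i j =
      (if D.evalFrom q (w.take i ++ w.drop j) ∈ D.accept then (1 : ℚ) else 0) -
        (if D.evalFrom q' (w.take i ++ w.drop j) ∈ D.accept then 1 else 0) := by
    intro i j
    rw [Matrix.mul_apply]
    simp only [A, B, sub_mul, Finset.sum_sub_distrib, ite_mul, one_mul,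
      zero_mul, Finset.sum_ite_eq', Finset.mem_univ, if_true, DFA.evalFrom_of_append]
  have htri : (A * B).BlockTriangular id := by
    intro i j hij
    have hij' : (j : ℕ) < i := hij
    have hi := i.isLt
    have hlen : w.length < (w.take i ++ w.drop j).length := by
      rw [List.length_append, List.length_take, List.length_drop]
      omega
    rw [hAB, if_congr (hlong _ hlen) rfl rfl, sub_self]
  have hdiag : ∀ i, (A * B) i i ≠ 0 := by
    intro i
    rw [hAB, List.take_append_drop]
    by_cases h : D.evalFrom q w ∈ D.accept <;> by_cases h' : D.evalFrom q' w ∈ D.accept <;>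
      simp_all
  have hdet : IsUnit (A * B).det := by
    rw [Matrix.det_of_isUpperTriangular htri]
    exact (Finset.prod_ne_zero_iff.2 fun i _ => hdiag i).isUnit
  have hrank := Matrix.rank_of_isUnit (A * B) ((Matrix.isUnit_iff_isUnit_det _).2 hdet)
  rw [Fintype.card_fin] at hrank
  calc w.length + 1 = (A * B).rank := hrank.symm
    _ ≤ A.rank := Matrix.rank_mul_le_left A B
    _ ≤ Fintype.card σ := A.rank_le_card_width

theorem PeriodFrom.add_mul {X : Set ℕ} {a p : ℕ} (h : PeriodFrom X a p) (m : ℕ) {n : ℕ}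
    (hn : a ≤ n) : n ∈ X ↔ n + p * m ∈ X := by
  induction m with
  | zero => simp
  | succ m ih =>
    rw [ih, Nat.mul_succ, ← add_assoc]
    exact h _ (hn.trans (Nat.le_add_right _ _))

theorem HasMinPeriod.dvd {X : Set ℕ} {ρ : ℕ} (h : HasMinPeriod X ρ) {b d : ℕ}
    (hd : PeriodFrom X b d) : ρ ∣ d := by
  obtain ⟨hρ, ⟨a, ha⟩, hmin⟩ := h
  rw [Nat.dvd_iff_mod_eq_zero]
  by_contra hne
  have hper : PeriodFrom X (max a b) (d % ρ) := by
    intro n hn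
    have h1 := ha.add_mul (d / ρ) (n := n + d % ρ)
      ((le_max_left a b).trans (hn.trans (Nat.le_add_right _ _)))
    rw [add_assoc, Nat.mod_add_div] at h1
    rw [h1]
    exact hd n ((le_max_right a b).trans hn)
  exact absurd (hmin _ (Nat.pos_of_ne_zero hne) ⟨_, hper⟩) (not_le.2 (Nat.mod_lt _ hρ))

/-- Translates of an ultimately periodic set that agree on one full period agree up to a
multiple of the minimal period. -/
theorem HasMinPeriod.exists_separating {X : Set ℕ} {ρ a A B : ℕ} (h : HasMinPeriod X ρ)
    (ha : PeriodFrom X a ρ) (hA : a ≤ A) (hAB : A ≤ B) (hdvd : ¬ ρ ∣ B - A) :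
    ∃ n < ρ, ¬ (A + n ∈ X ↔ B + n ∈ X) := by
  by_contra! hcon
  refine hdvd (h.dvd (b := A) fun n hn => ?_)
  have hlt := Nat.mod_lt (n - A) h.1
  have h1 := ha.add_mul ((n - A) / ρ) (n := A + (n - A) % ρ) (hA.trans (Nat.le_add_right _ _))
  have h2 := ha.add_mul ((n - A) / ρ) (n := B + (n - A) % ρ)
    ((hA.trans hAB).trans (Nat.le_add_right _ _))
  rw [add_assoc, Nat.mod_add_div] at h1 h2
  rw [show n + (B - A) = B + (n - A) by omega, ← h2, ← hcon _ hlt, h1,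
    show A + (n - A) = n by omega]

theorem lt_repLen {U : ℕ → ℕ} (hU : StrictMono U) (n : ℕ) : n < U (repLen U n) :=
  Nat.sInf_mem (s := {l : ℕ | n < U l})
    ⟨n + 1, (Nat.lt_succ_self n).trans_le (hU.id_le (n + 1))⟩

/-- Two numbers `u ≡ v` modulo `Q`, with `P` dividing both, are congruent modulo `Q * P` when
`Q` and `P` are coprime. -/
theorem mul_dvd_sub_of_mod_eq {Q P u v : ℕ} (hQP : Q.Coprime P) (huv : u ≤ v)
    (hmod : v % Q = u % Q) (hu : P ∣ u) (hv : P ∣ v) : Q * P ∣ v - u :=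
  hQP.mul_dvd_of_dvd_of_dvd ((Nat.modEq_iff_dvd' huv).1 hmod.symm) (Nat.dvd_sub hv hu)

/-- Under (H1)–(H3), for a linear numeration system whose coefficients
are all divisible by the primes `p j`, with `Z` as in Lemma `10^z w`, `X` ultimately
periodic with period `Q * ∏ p j ^ μ j`, `X ∩ (Qℕ + r)` of minimal period
`ρ = Q * ∏ p j ^ ν j`, `M = max_j f_{p j}(ν j)` satisfying
`M - 1 - |rep_U(ρ-1)| ≥ Z` and `M >` the preperiod of `(U i mod Q)`, and `γ` bounding the
number of states of DFAs for the languages `0* rep_U(Qℕ + r')`: every DFA accepting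
`0* rep_U(X)` has at least `(|rep_U(ρ-1)| + 1) / γ` states. -/
theorem stmt8 (U : ℕ → ℕ) (hU : IsNumSys U)
    (h1 : IsRegularLang {w : List ℕ | IsGreedyRep U w})
    (h2 : GapsUnbounded U) (h3 : GapsUltNondecreasing U)
    (k : ℕ) (hk : 1 ≤ k) (a : Fin k → ℤ) (ha0 : a ⟨0, hk⟩ ≠ 0) (N : ℕ)
    (hrec : ∀ i ≥ N, (U (i + k) : ℤ) = ∑ j : Fin k, a j * U (i + (j : ℕ)))
    (Z : ℕ)
    (hZ : ∀ w : List ℕ, IsGreedyRep U w →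
      ∀ z ≥ Z, IsGreedyRep U (1 :: (List.replicate z 0 ++ w)))
    (X : Set ℕ) (t : ℕ) (ht : 1 ≤ t) (Q : ℕ)
    (p : Fin t → ℕ) (μ : Fin t → ℕ)
    (hp : ∀ j, (p j).Prime) (hinj : Function.Injective p)
    (hpa : ∀ (j : Fin t) (m : Fin k), (p j : ℤ) ∣ a m)
    (hμ : ∀ j, 1 ≤ μ j)
    (hQ : ∀ q : ℕ, q.Prime → q ∣ Q → ¬ ∀ m : Fin k, (q : ℤ) ∣ a m)
    (hX : HasMinPeriod X (Q * ∏ j, p j ^ μ j))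
    (r : ℕ) (hr : r < Q) (ν : Fin t → ℕ) (ρ : ℕ) (hρ : ρ = Q * ∏ j, p j ^ ν j)
    (hX' : HasMinPeriod (X ∩ {n : ℕ | n % Q = r}) ρ)
    (F : Fin t → ℕ)
    (hF : ∀ j : Fin t, (∀ i ≥ F j, p j ^ ν j ∣ U i) ∧
      ∀ F' : ℕ, (∀ i ≥ F', p j ^ ν j ∣ U i) → F j ≤ F')
    (M : ℕ) (hM : M = Finset.univ.sup F)
    (hMZ : repLen U (ρ - 1) + 1 + Z ≤ M)
    (Pre : ℕ)
    (hPre : (∃ π : ℕ, 1 ≤ π ∧ ∀ i ≥ Pre, U (i + π) % Q = U i % Q) ∧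
      ∀ Pre' : ℕ, (∃ π : ℕ, 1 ≤ π ∧ ∀ i ≥ Pre', U (i + π) % Q = U i % Q) → Pre ≤ Pre')
    (hPreM : Pre < M)
    (γ : ℕ) (hγ : 1 ≤ γ)
    (hγQ : ∀ r' < Q, ∃ (σ : Type) (_ : Fintype σ) (D : DFA ℕ σ),
      Fintype.card σ ≤ γ ∧ D.accepts = zeroStarRepLang U {n : ℕ | n % Q = r'})
    (σ : Type) [Fintype σ] (D : DFA ℕ σ) (hD : D.accepts = zeroStarRepLang U X) :
    ((repLen U (ρ - 1) + 1 : ℕ) : ℝ) / (γ : ℝ) ≤ (Fintype.card σ : ℝ) := by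
  classical
  obtain ⟨σ', hσ', D', hcard, hD'⟩ := hγQ r hr
  set l := repLen U (ρ - 1)
  set P := ∏ j, p j ^ ν j
  obtain ⟨b, hb⟩ := hX'.2.1
  obtain ⟨⟨π, hπ, hper⟩, -⟩ := hPre
  have hdvdU : ∀ j, ∀ i ≥ M, p j ^ ν j ∣ U i := fun j i hi =>
    (hF j).1 i (((Finset.le_sup (Finset.mem_univ j)).trans hM.ge).trans hi)
  have hPU : ∀ i ≥ M, P ∣ U i := fun i hi =>
    Finset.prod_dvd_of_isRelPrime
      (fun j _ j' _ hjj' => Nat.coprime_iff_isRelPrime.1 <| Nat.Coprime.pow _ _ <|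
        (Nat.coprime_primes (hp j) (hp j')).2 (hinj.ne hjj'))
      (fun j _ => hdvdU j i hi)
  have hQP : Q.Coprime P := by
    refine Nat.Coprime.prod_right fun j _ => Nat.Coprime.pow_right _ ?_
    refine ((Nat.Prime.coprime_iff_not_dvd (hp j)).2 fun hdvd => ?_).symm
    exact hQ (p j) (hp j) hdvd (hpa j)
  have : Nonempty (Fin t) := ⟨⟨0, ht⟩⟩
  obtain ⟨j, -, hj⟩ := Finset.exists_mem_eq_sup Finset.univ Finset.univ_nonempty F
  have hM1 : ¬ p j ^ ν j ∣ U (M - 1) := by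
    intro hdvd
    have := (hF j).2 (M - 1) fun i hi => by
      rcases eq_or_lt_of_le hi with rfl | hi
      · exact hdvd
      · exact hdvdU j i (by omega)
    omega
  set m := M - 1 - l with hm
  have hml : m + l = M - 1 := by omega
  let W : ℕ → ℕ → List ℕ → List ℕ := fun y z x =>
    1 :: (List.replicate y 0 ++ (1 :: (List.replicate z 0 ++ x)))
  have hWgreedy : ∀ y z x, Z ≤ y → Z ≤ z → (IsGreedyPadded U (W y z x) ↔ IsGreedyPadded U x) := by
    intro y z x hy hz
    refine ⟨fun h => ?_, fun h =>
      (h.one_cons_replicate_zero_append hZ hz).one_cons_replicate_zero_append hZ hy⟩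
    exact IsGreedyPadded.of_append (u := 1 :: (List.replicate y 0 ++ 1 :: List.replicate z 0))
      (by simpa [W] using h)
  have hWval : ∀ y z x, valU U (W y z x) =
      U (y + z + 1 + x.length) + U (z + x.length) + valU U x := by
    intro y z x
    simp only [W]
    rw [valU_one_cons_replicate_zero_append, valU_one_cons_replicate_zero_append, ← add_assoc]
    congr 3
    simp only [List.length_cons, List.length_append, List.length_replicate]
    ring
  let E := D.inter D'
  have hE : ∀ x, E.evalFrom E.start x ∈ E.accept ↔
      IsGreedyPadded U x ∧ valU U x ∈ X ∩ {n : ℕ | n % Q = r} := by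
    intro x
    change x ∈ (D.inter D').accepts ↔ _
    rw [DFA.accepts_inter, hD, hD']
    change x ∈ zeroStarRepLang U X ∧ x ∈ zeroStarRepLang U _ ↔ _
    rw [mem_zeroStarRepLang_iff hU, mem_zeroStarRepLang_iff hU, Set.mem_inter_iff]
    tauto
  let T := Z + b
  let q := E.evalFrom E.start (W (T + π) m [])
  let q' := E.evalFrom E.start (W T (m + π) [])
  have hstate : ∀ y z x, E.evalFrom (E.evalFrom E.start (W y z [])) x =
      E.evalFrom E.start (W y z x) := by
    intro y z x
    rw [← DFA.evalFrom_of_append]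
    simp [W]
  have hq : ∀ x, E.evalFrom q x ∈ E.accept ↔ IsGreedyPadded U x ∧
      U (T + m + π + 1 + x.length) + U (m + x.length) + valU U x ∈
        X ∩ {n : ℕ | n % Q = r} := by
    intro x
    rw [hstate, hE, hWgreedy _ _ _ (by omega) (by omega), hWval,
      show T + π + m + 1 + x.length = T + m + π + 1 + x.length by ring]
  have hq' : ∀ x, E.evalFrom q' x ∈ E.accept ↔ IsGreedyPadded U x ∧
      U (T + m + π + 1 + x.length) + U (m + x.length + π) + valU U x ∈
        X ∩ {n : ℕ | n % Q = r} := by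
    intro x
    rw [hstate, hE, hWgreedy _ _ _ (by omega) (by omega), hWval,
      show T + (m + π) + 1 + x.length = T + m + π + 1 + x.length by ring,
      show m + π + x.length = m + x.length + π by ring]
  have hbU : ∀ s, b ≤ U (T + m + π + 1 + s) := fun s =>
    (by omega : b ≤ T + m + π + 1 + s).trans (hU.mono.id_le _)
  have hUπ : ∀ i, U i ≤ U (i + π) := fun i => hU.mono.monotone (Nat.le_add_right i π)
  have hnd : ¬ ρ ∣ (U (T + m + π + 1 + l) + U (m + l + π)) -
      (U (T + m + π + 1 + l) + U (m + l)) := by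
    rw [Nat.add_sub_add_left, hml]
    intro hdvd
    have hpρ : p j ^ ν j ∣ ρ := by
      rw [hρ]
      exact (Finset.dvd_prod_of_mem (fun j => p j ^ ν j) (Finset.mem_univ j)).mul_left Q
    exact hM1 ((Nat.dvd_sub_iff_right (hUπ _) (hdvdU j _ (by omega))).1 (hpρ.trans hdvd))
  obtain ⟨n, hn, hsep⟩ := hX'.exists_separating hb ((hbU l).trans (Nat.le_add_right _ _))
    (Nat.add_le_add_left (hUπ (m + l)) _) hnd
  obtain ⟨w, hwl, hw, hwn⟩ := exists_isGreedyPadded_valU_eq hU l n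
    (lt_of_le_of_lt (Nat.le_sub_one_of_lt hn) (lt_repLen hU.mono (ρ - 1)))
  have hmain := E.length_succ_le_card q q' w
    (by
      rw [hq, hq', hwl, hwn]
      simpa only [hw, true_and] using hsep)
    (by
      intro x hx
      rw [hq, hq']
      obtain ⟨c, hc⟩ : ρ ∣ U (m + x.length + π) - U (m + x.length) := by
        rw [hρ]
        exact mul_dvd_sub_of_mod_eq hQP (hUπ _) (hper _ (by omega)) (hPU _ (by omega))
          (hPU _ (by omega))
      have h := hb.add_mul c
        (n := U (T + m + π + 1 + x.length) + U (m + x.length) + valU U x)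
        ((hbU x.length).trans (by omega))
      have hle := hUπ (m + x.length)
      rw [h, ← hc, show U (T + m + π + 1 + x.length) + U (m + x.length) + valU U x +
        (U (m + x.length + π) - U (m + x.length)) =
        U (T + m + π + 1 + x.length) + U (m + x.length + π) + valU U x by omega])
  rw [hwl, Fintype.card_prod] at hmain
  rw [div_le_iff₀ (by exact_mod_cast hγ)]
  exact_mod_cast hmain.trans (Nat.mul_le_mul_left _ hcard)
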